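/- For every local model on the two-source network in which source S₁ connects parties A¹, A², A³ and source S₂ connects parties A³, A⁴, setting S₊ = ⟨(a¹_0 a²_1 + a¹_1 a²_0)/2 · a³_0 · (a⁴_0 + a⁴_1)/2⟩ and S₋ = ⟨(a¹_0 a²_0 − a¹_1 a²_1)/2 · a³_1 · (a⁴_0 − a⁴_1)/2⟩, at least one of the following holds: there exists q ∈ (0,1) with S₊/q + S₋/(1−q) ≤ 1; or S₋ = 0 and S₊ ≤ 1; or S₊ = 0 and S₋ ≤ 1. -/

import Mathlib

open MeasureTheory

theorem abs_integral_mul_mul_le {α β : Type*} [MeasurableSpace α] [MeasurableSpace β]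
    {μ : Measure α} {ν : Measure β} [SFinite μ] [SFinite ν]
    {u : α → ℝ} {v : β → ℝ} (w : α × β → ℝ) (hu : Integrable u μ) (hv : Integrable v ν)
    (hw : ∀ p, |w p| ≤ 1) :
    |∫ p, u p.1 * w p * v p.2 ∂(μ.prod ν)| ≤ (∫ x, |u x| ∂μ) * ∫ y, |v y| ∂ν := by
  rw [← integral_prod_mul, ← Real.norm_eq_abs]
  refine norm_integral_le_of_norm_le (hu.abs.mul_prod hv.abs) (.of_forall fun p => ?_)
  rw [Real.norm_eq_abs, abs_mul, abs_mul]
  gcongr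
  exact mul_le_of_le_one_right (abs_nonneg _) (hw p)

theorem integral_abs_add_integral_abs_eq_one {α : Type*} [MeasurableSpace α] {μ : Measure α}
    [IsProbabilityMeasure μ] {f g : α → ℝ} (hf : Measurable f) (hg : Measurable g)
    (hfg : ∀ x, |f x| + |g x| = 1) :
    Integrable f μ ∧ Integrable g μ ∧ (∫ x, |f x| ∂μ) + ∫ x, |g x| ∂μ = 1 := by
  have hfi : Integrable f μ := .of_bound hf.aestronglyMeasurable 1 <| .of_forall fun x => by
    rw [Real.norm_eq_abs]; linarith [hfg x, abs_nonneg (g x)]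
  have hgi : Integrable g μ := .of_bound hg.aestronglyMeasurable 1 <| .of_forall fun x => by
    rw [Real.norm_eq_abs]; linarith [hfg x, abs_nonneg (f x)]
  refine ⟨hfi, hgi, ?_⟩
  rw [← integral_add hfi.abs hgi.abs]
  simp [hfg]

theorem exists_div_add_div_le_one_or {s t r r' q q' : ℝ} (hr : 0 ≤ r) (hr' : 0 ≤ r')
    (hrr : r + r' = 1) (hq : 0 ≤ q) (hq' : 0 ≤ q') (hqq : q + q' = 1)
    (hs : |s| ≤ r * q) (ht : |t| ≤ r' * q') :
    (∃ q ∈ Set.Ioo (0 : ℝ) 1, s / q + t / (1 - q) ≤ 1) ∨ (t = 0 ∧ s ≤ 1) ∨ (s = 0 ∧ t ≤ 1) := by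
  obtain rfl : q' = 1 - q := by linarith
  have hs' := (le_abs_self s).trans hs
  have ht' := (le_abs_self t).trans ht
  rcases hq.eq_or_lt with rfl | hq0
  · exact .inr (.inr ⟨abs_eq_zero.1 (le_antisymm (by simpa using hs) (abs_nonneg s)), by linarith⟩)
  rcases hq'.eq_or_lt with hq1 | hq1
  · rw [← hq1, mul_zero] at ht
    obtain rfl : q = 1 := by linarith
    exact .inr (.inl ⟨abs_eq_zero.1 (le_antisymm ht (abs_nonneg t)), by linarith⟩)
  · refine .inl ⟨q, ⟨hq0, by linarith⟩, ?_⟩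
    rw [← div_le_iff₀ hq0] at hs'
    rw [← div_le_iff₀ hq1] at ht'
    linarith

/-- For every local model on the two-source network in which source `S₁` connects parties
`A¹, A², A³` and source `S₂` connects parties `A³, A⁴` (measurable ±1-valued responses
`a¹, a² : {0,1}×Λ₁ → {−1,1}`, `a³ : {0,1}×Λ₁×Λ₂ → {−1,1}`, `a⁴ : {0,1}×Λ₂ → {−1,1}`),
setting `S₊ = ⟨(a¹_0 a²_1 + a¹_1 a²_0)/2 · a³_0 · (a⁴_0 + a⁴_1)/2⟩` and
`S₋ = ⟨(a¹_0 a²_0 − a¹_1 a²_1)/2 · a³_1 · (a⁴_0 − a⁴_1)/2⟩`, at least one of the following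
holds: there exists `q ∈ (0,1)` with `S₊/q + S₋/(1−q) ≤ 1`; or `S₋ = 0` and `S₊ ≤ 1`;
or `S₊ = 0` and `S₋ ≤ 1`. -/
theorem mermin_network_quantifier_inequality
    {Λ₁ Λ₂ : Type} [MeasurableSpace Λ₁] [MeasurableSpace Λ₂]
    (ρ₁ : Measure Λ₁) (ρ₂ : Measure Λ₂)
    [IsProbabilityMeasure ρ₁] [IsProbabilityMeasure ρ₂]
    (a₁ a₂ : Fin 2 → Λ₁ → ℝ) (a₃ : Fin 2 → Λ₁ → Λ₂ → ℝ) (a₄ : Fin 2 → Λ₂ → ℝ)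
    (ha₁_meas : ∀ x, Measurable (a₁ x)) (ha₂_meas : ∀ x, Measurable (a₂ x))
    (ha₃_meas : ∀ x, Measurable (fun p : Λ₁ × Λ₂ => a₃ x p.1 p.2))
    (ha₄_meas : ∀ x, Measurable (a₄ x))
    (ha₁_val : ∀ x l₁, a₁ x l₁ = 1 ∨ a₁ x l₁ = -1)
    (ha₂_val : ∀ x l₁, a₂ x l₁ = 1 ∨ a₂ x l₁ = -1)
    (ha₃_val : ∀ x l₁ l₂, a₃ x l₁ l₂ = 1 ∨ a₃ x l₁ l₂ = -1)
    (ha₄_val : ∀ x l₂, a₄ x l₂ = 1 ∨ a₄ x l₂ = -1)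
    (Sp Sm : ℝ)
    (hSp : Sp = ∫ p, ((a₁ 0 p.1 * a₂ 1 p.1 + a₁ 1 p.1 * a₂ 0 p.1) / 2) * a₃ 0 p.1 p.2
        * ((a₄ 0 p.2 + a₄ 1 p.2) / 2) ∂(ρ₁.prod ρ₂))
    (hSm : Sm = ∫ p, ((a₁ 0 p.1 * a₂ 0 p.1 - a₁ 1 p.1 * a₂ 1 p.1) / 2) * a₃ 1 p.1 p.2
        * ((a₄ 0 p.2 - a₄ 1 p.2) / 2) ∂(ρ₁.prod ρ₂)) :
    (∃ q ∈ Set.Ioo (0:ℝ) 1, Sp / q + Sm / (1 - q) ≤ 1)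
      ∨ (Sm = 0 ∧ Sp ≤ 1) ∨ (Sp = 0 ∧ Sm ≤ 1) := by
  have abs_le_one {x : ℝ} (hx : x = 1 ∨ x = -1) : |x| ≤ 1 := by rcases hx with rfl | rfl <;> simp
  obtain ⟨hu, hu', huu⟩ := integral_abs_add_integral_abs_eq_one (μ := ρ₁)
    (f := fun l => (a₁ 0 l * a₂ 1 l + a₁ 1 l * a₂ 0 l) / 2)
    (g := fun l => (a₁ 0 l * a₂ 0 l - a₁ 1 l * a₂ 1 l) / 2)
    (by fun_prop) (by fun_prop) fun l => by
      rcases ha₁_val 0 l with h | h <;> rcases ha₁_val 1 l with h' | h' <;>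
        rcases ha₂_val 0 l with k | k <;> rcases ha₂_val 1 l with k' | k' <;>
        rw [h, h', k, k'] <;> norm_num
  obtain ⟨hv, hv', hvv⟩ := integral_abs_add_integral_abs_eq_one (μ := ρ₂)
    (f := fun l => (a₄ 0 l + a₄ 1 l) / 2) (g := fun l => (a₄ 0 l - a₄ 1 l) / 2)
    (by fun_prop) (by fun_prop) fun l => by
      rcases ha₄_val 0 l with h | h <;> rcases ha₄_val 1 l with h' | h' <;>
        rw [h, h'] <;> norm_num
  rw [hSp, hSm]
  exact exists_div_add_div_le_one_or
    (integral_nonneg fun _ => abs_nonneg _) (integral_nonneg fun _ => abs_nonneg _) huu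
    (integral_nonneg fun _ => abs_nonneg _) (integral_nonneg fun _ => abs_nonneg _) hvv
    (abs_integral_mul_mul_le (fun p => a₃ 0 p.1 p.2) hu hv fun p => abs_le_one (ha₃_val 0 p.1 p.2))
    (abs_integral_mul_mul_le (fun p => a₃ 1 p.1 p.2) hu' hv'
      fun p => abs_le_one (ha₃_val 1 p.1 p.2))
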